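/- Let A be a finite group and, for each positive integer s, let N^A_s denote the number of connected components of the quiver of Ss^0_A having exactly s vertices. Then N^A_s = 0 whenever s does not divide |A|, and ∑_s s·N^A_s = |Aut(A)|^{|A|-1}. -/

import Mathlib

/-- The holomorph `Hol(A) = A ⋊ Aut(A)`, with `Aut(A)` acting on `A` by evaluation;
elements are pairs `⟨a, f⟩` with multiplication `⟨a,f⟩⟨b,g⟩ = ⟨a·f(b), f∘g⟩`. -/
abbrev Hol (A : Type u) [Group A] :=
  SemidirectProduct A (MulAut A) (MonoidHom.id (MulAut A))

/-- A subset `S ⊆ Hol(A)` is regular if for every `a ∈ A` there is a unique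
`f ∈ Aut(A)` with `(a, f) ∈ S`. -/
def IsRegularSubset {A : Type u} [Group A] (S : Set (Hol A)) : Prop :=
  ∀ a : A, ∃! f : MulAut A, (⟨a, f⟩ : Hol A) ∈ S

/-- For a subset `S ⊆ Hol(A)` and a label `a ∈ A`, the translate
`(a, f^S_a)⁻¹ • S` (for `S` regular, `f^S_a` is the unique automorphism paired with
`a`); this is the target of the arrow with source `S` and label `a` in the quiver
associated with a family of regular subsets. -/
def trg {A : Type u} [Group A] (S : Set (Hol A)) (a : A) : Set (Hol A) :=
  {β : Hol A | ∃ f : MulAut A, (⟨a, f⟩ : Hol A) ∈ S ∧ (⟨a, f⟩ : Hol A) * β ∈ S}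

/-- Adjacency in (the underlying undirected graph of) the quiver of `Ss⁰_A`, whose
vertices are the regular subsets of `Hol(A)` containing `(1_A, id)` and whose arrows
go from `S` to `(a, f^S_a)⁻¹ S` for each `a ∈ A`. Connected components are given by
`Relation.EqvGen` of this relation. -/
def adj0 {A : Type u} [Group A] (S S' : Set (Hol A)) : Prop :=
  (IsRegularSubset S ∧ (⟨1, 1⟩ : Hol A) ∈ S) ∧
  (IsRegularSubset S' ∧ (⟨1, 1⟩ : Hol A) ∈ S') ∧
  ∃ a : A, trg S a = S'

/-- `C` is (the vertex set of) a connected component of the quiver of `Ss⁰_A`. -/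
def IsComponent0 {A : Type u} [Group A] (C : Set (Set (Hol A))) : Prop :=
  ∃ S₀ : Set (Hol A), (IsRegularSubset S₀ ∧ (⟨1, 1⟩ : Hol A) ∈ S₀) ∧
    C = {S : Set (Hol A) |
      (IsRegularSubset S ∧ (⟨1, 1⟩ : Hol A) ∈ S) ∧ Relation.EqvGen adj0 S₀ S}

/-- `N^A_s`: the number of connected components of the quiver of `Ss⁰_A` having
exactly `s` vertices. -/
noncomputable def Ncomp (A : Type u) [Group A] (s : ℕ) : ℕ :=
  Nat.card {C : Set (Set (Hol A)) // IsComponent0 C ∧ Nat.card C = s}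

/-- The left translate `s⁻¹ S`, written as a preimage. -/
def leftTranslate {G : Type*} [Group G] (s : G) (S : Set G) : Set G :=
  {β : G | s * β ∈ S}

/-- The translates of `S` by the inverses of its own elements. -/
def selfTranslates {G : Type*} [Group G] (S : Set G) : Set (Set G) :=
  {T : Set G | ∃ s ∈ S, T = leftTranslate s S}

section Translates

variable {G : Type*} [Group G]

theorem leftTranslate_leftTranslate (s t : G) (S : Set G) :
    leftTranslate t (leftTranslate s S) = leftTranslate (s * t) S := by
  ext β
  simp [leftTranslate, mul_assoc]

theorem leftTranslate_one (S : Set G) : leftTranslate 1 S = S := by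
  ext β
  simp [leftTranslate]

theorem self_mem_selfTranslates {S : Set G} (h : 1 ∈ S) : S ∈ selfTranslates S :=
  ⟨1, h, (leftTranslate_one S).symm⟩

theorem selfTranslates_leftTranslate {S : Set G} (s : G) :
    selfTranslates (leftTranslate s S) = selfTranslates S := by
  ext T
  constructor
  · rintro ⟨t, ht, rfl⟩
    exact ⟨s * t, ht, leftTranslate_leftTranslate s t S⟩
  · rintro ⟨t, ht, rfl⟩
    refine ⟨s⁻¹ * t, by simpa [leftTranslate] using ht, ?_⟩
    simp [leftTranslate_leftTranslate]

theorem selfTranslates_eq_of_mem {S T : Set G} (h : T ∈ selfTranslates S) :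
    selfTranslates T = selfTranslates S := by
  obtain ⟨s, -, rfl⟩ := h
  exact selfTranslates_leftTranslate s

/-- The stabilizer of `S` under left translation acts freely on `S`, and its orbits are
the fibres of `s ↦ s⁻¹ S`. -/
theorem card_selfTranslates_dvd (S : Set G) : Nat.card (selfTranslates S) ∣ Nat.card S := by
  choose sec hsec hsec' using fun T : selfTranslates S => T.2
  let e : {h : G // leftTranslate h S = S} × selfTranslates S → S := fun p =>
    ⟨p.1.1 * sec p.2, (Set.ext_iff.1 p.1.2 (sec p.2)).2 (hsec p.2)⟩
  have he : Function.Bijective e := by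
    constructor
    · rintro ⟨⟨h, hh⟩, T⟩ ⟨⟨k, hk⟩, U⟩ heq
      have heq' : h * sec T = k * sec U := congrArg Subtype.val heq
      have hTU : T = U := by
        apply Subtype.ext
        rw [hsec' T, hsec' U, ← congrArg (leftTranslate (sec T)) hh,
          ← congrArg (leftTranslate (sec U)) hk, leftTranslate_leftTranslate,
          leftTranslate_leftTranslate, heq']
      subst hTU
      have hk' : h = k := mul_right_cancel heq'
      subst hk'
      rfl
    · rintro ⟨s, hs⟩
      let T : selfTranslates S := ⟨leftTranslate s S, s, hs, rfl⟩
      refine ⟨⟨⟨s * (sec T)⁻¹, ?_⟩, T⟩, Subtype.ext (by simp [e])⟩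
      rw [← leftTranslate_leftTranslate, show leftTranslate s S = leftTranslate (sec T) S from
        hsec' T, leftTranslate_leftTranslate, mul_inv_cancel, leftTranslate_one]
  rw [← Nat.card_eq_of_bijective e he, Nat.card_prod]
  exact dvd_mul_left _ _

end Translates

section Holomorph

variable {A : Type*} [Group A]

/-- The vertices of the quiver of `Ss⁰_A`. -/
def IsVertex (S : Set (Hol A)) : Prop :=
  IsRegularSubset S ∧ (⟨1, 1⟩ : Hol A) ∈ S

theorem IsRegularSubset.eq_of_left_eq {S : Set (Hol A)} (h : IsRegularSubset S) {s t : Hol A}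
    (hs : s ∈ S) (ht : t ∈ S) (hst : s.left = t.left) : s = t := by
  obtain ⟨a, f⟩ := s
  obtain ⟨b, g⟩ := t
  obtain rfl : a = b := hst
  rw [(h a).unique hs ht]

theorem IsRegularSubset.trg_eq {S : Set (Hol A)} (h : IsRegularSubset S) {s : Hol A}
    (hs : s ∈ S) : trg S s.left = leftTranslate s S := by
  ext β
  constructor
  · rintro ⟨f, hf, hβ⟩
    rwa [h.eq_of_left_eq hf hs rfl] at hβ
  · exact fun hβ => ⟨s.right, hs, hβ⟩

theorem IsRegularSubset.isVertex_leftTranslate {S : Set (Hol A)} (h : IsRegularSubset S)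
    {s : Hol A} (hs : s ∈ S) : IsVertex (leftTranslate s S) := by
  refine ⟨fun a => ?_, ?_⟩
  · obtain ⟨f, hf, -⟩ := h (s.left * s.right a)
    refine ⟨s.right⁻¹ * f, ?_, fun g hg => ?_⟩
    · change s * _ ∈ S
      convert hf using 1
      ext <;> simp
    · have := h.eq_of_left_eq (s := s * ⟨a, g⟩) hg hf (by simp)
      have := congrArg SemidirectProduct.right this
      simp only [SemidirectProduct.mul_right] at this
      rw [← this, inv_mul_cancel_left]
  · change s * 1 ∈ S
    rwa [mul_one]

theorem adj0_iff {S T : Set (Hol A)} :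
    adj0 S T ↔ IsVertex S ∧ T ∈ selfTranslates S := by
  constructor
  · rintro ⟨hS, -, a, rfl⟩
    obtain ⟨f, hf, -⟩ := hS.1 a
    exact ⟨hS, ⟨a, f⟩, hf, hS.1.trg_eq hf⟩
  · rintro ⟨hS, s, hs, rfl⟩
    exact ⟨hS, hS.1.isVertex_leftTranslate hs, s.left, hS.1.trg_eq hs⟩

theorem IsVertex.component_eq {S : Set (Hol A)} (hS : IsVertex S) :
    {T : Set (Hol A) | (IsRegularSubset T ∧ (⟨1, 1⟩ : Hol A) ∈ T) ∧ Relation.EqvGen adj0 S T} =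
      selfTranslates S := by
  have key : ∀ T U : Set (Hol A), Relation.EqvGen adj0 T U →
      selfTranslates T = selfTranslates U := by
    intro T U h
    induction h with
    | rel _ _ h => exact (selfTranslates_eq_of_mem (adj0_iff.1 h).2).symm
    | refl => rfl
    | symm _ _ _ ih => exact ih.symm
    | trans _ _ _ _ _ ih₁ ih₂ => exact ih₁.trans ih₂
  ext T
  constructor
  · rintro ⟨hT, h⟩
    rw [key S T h]
    exact self_mem_selfTranslates hT.2
  · intro h
    refine ⟨?_, .rel _ _ (adj0_iff.2 ⟨hS, h⟩)⟩
    obtain ⟨s, hs, rfl⟩ := h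
    exact hS.1.isVertex_leftTranslate hs

theorem isComponent0_iff {C : Set (Set (Hol A))} :
    IsComponent0 C ↔ ∃ S, IsVertex S ∧ C = selfTranslates S := by
  refine exists_congr fun S => and_congr_right fun hS => ?_
  rw [IsVertex.component_eq hS]

theorem IsRegularSubset.card_eq {S : Set (Hol A)} (h : IsRegularSubset S) :
    Nat.card S = Nat.card A := by
  refine Nat.card_eq_of_bijective (fun s : S => s.1.left) ⟨fun s t hst => ?_, fun a => ?_⟩
  · exact Subtype.ext (h.eq_of_left_eq s.2 t.2 hst)
  · obtain ⟨f, hf, -⟩ := h a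
    exact ⟨⟨⟨a, f⟩, hf⟩, rfl⟩

theorem IsComponent0.card_dvd {C : Set (Set (Hol A))} (h : IsComponent0 C) :
    Nat.card C ∣ Nat.card A := by
  obtain ⟨S, hS, rfl⟩ := isComponent0_iff.1 h
  rw [← hS.1.card_eq]
  exact card_selfTranslates_dvd S

theorem IsComponent0.nonempty {C : Set (Set (Hol A))} (h : IsComponent0 C) : C.Nonempty := by
  obtain ⟨S, hS, rfl⟩ := isComponent0_iff.1 h
  exact ⟨S, self_mem_selfTranslates hS.2⟩

theorem card_isVertex [Finite A] :
    Nat.card {S : Set (Hol A) // IsVertex S} = Nat.card (MulAut A) ^ (Nat.card A - 1) := by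
  classical
  let F : ({a : A // a ≠ 1} → MulAut A) → A → MulAut A := fun g a =>
    if h : a = 1 then 1 else g ⟨a, h⟩
  let e : ({a : A // a ≠ 1} → MulAut A) → {S : Set (Hol A) // IsVertex S} := fun g =>
    ⟨{x | x.right = F g x.left}, fun a => ⟨F g a, rfl, fun f hf => hf⟩, by simp [F]⟩
  have he : Function.Bijective e := by
    constructor
    · intro g g' h
      funext a
      have ha : (⟨a, F g a⟩ : Hol A) ∈ (e g).1 := rfl
      rw [h] at ha
      have ha' : F g a = F g' a := ha
      simpa [F, a.2] using ha'
    · rintro ⟨S, hS⟩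
      choose f hf _ using hS.1
      refine ⟨fun a => f a, Subtype.ext ?_⟩
      have hF : F (fun a => f a) = f := by
        funext a
        by_cases h : a = 1
        · subst h
          simpa [F] using (hS.1 1).unique hS.2 (hf 1)
        · simp [F, h]
      ext x
      change x.right = F (fun a => f a) x.left ↔ _
      rw [hF]
      constructor
      · intro hx
        have := hf x.left
        rwa [← hx] at this
      · exact fun hx => (hS.1 x.left).unique hx (hf x.left)
  have := Fintype.ofFinite A
  rw [← Nat.card_eq_of_bijective e he, Nat.card_fun]
  congr 1
  simp

theorem card_isVertex_eq_sum [Fintype {C : Set (Set (Hol A)) // IsComponent0 C}]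
    [Finite (Hol A)] :
    Nat.card {S : Set (Hol A) // IsVertex S} =
      ∑ C : {C : Set (Set (Hol A)) // IsComponent0 C}, Nat.card C.1 := by
  rw [← Nat.card_sigma]
  symm
  refine Nat.card_eq_of_bijective (fun p => ⟨p.2.1, ?_⟩) ⟨?_, ?_⟩
  · obtain ⟨⟨C, hC⟩, T, hT⟩ := p
    obtain ⟨S, hS, rfl⟩ := isComponent0_iff.1 hC
    obtain ⟨s, hs, rfl⟩ := hT
    exact hS.1.isVertex_leftTranslate hs
  · rintro ⟨⟨C, hC⟩, T, hT⟩ ⟨⟨D, hD⟩, U, hU⟩ h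
    obtain rfl : T = U := congrArg Subtype.val h
    obtain ⟨S, hS, rfl⟩ := isComponent0_iff.1 hC
    obtain ⟨S', hS', rfl⟩ := isComponent0_iff.1 hD
    have hSS' : selfTranslates S = selfTranslates S' :=
      (selfTranslates_eq_of_mem hT).symm.trans (selfTranslates_eq_of_mem hU)
    congr!
  · rintro ⟨S, hS⟩
    exact ⟨⟨⟨selfTranslates S, isComponent0_iff.2 ⟨S, hS, rfl⟩⟩, S,
      self_mem_selfTranslates hS.2⟩, rfl⟩

end Holomorph

/-- Let `A` be a finite group. Then `N^A_s = 0` whenever `s` does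
not divide `|A|`, and `∑_s s · N^A_s = |Aut(A)|^(|A|−1)`. -/
theorem Ncomp_relations (A : Type u) [Group A] [Fintype A] :
    (∀ s : ℕ, 0 < s → ¬ s ∣ Nat.card A → Ncomp A s = 0) ∧
    (∑ s ∈ Finset.Icc 1 (Nat.card A), s * Ncomp A s =
      Nat.card (MulAut A) ^ (Nat.card A - 1)) := by
  classical
  constructor
  · intro s _ hs
    have : IsEmpty {C : Set (Set (Hol A)) // IsComponent0 C ∧ Nat.card C = s} :=
      ⟨fun C => hs (C.2.2 ▸ C.2.1.card_dvd)⟩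
    exact Nat.card_of_isEmpty
  · have : Finite (Hol A) := Finite.of_equiv _ SemidirectProduct.equivProd.symm
    have := Fintype.ofFinite {C : Set (Set (Hol A)) // IsComponent0 C}
    rw [← card_isVertex, card_isVertex_eq_sum,
      ← Finset.sum_fiberwise_of_maps_to (t := Finset.Icc 1 (Nat.card A))
        (g := fun C : {C : Set (Set (Hol A)) // IsComponent0 C} => Nat.card C.1)]
    · refine Finset.sum_congr rfl fun s _ => ?_
      rw [Finset.sum_congr rfl fun C hC => (Finset.mem_filter.1 hC).2, Finset.sum_const,
        smul_eq_mul, mul_comm, Ncomp,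
        ← Nat.card_congr (Equiv.subtypeSubtypeEquivSubtypeInter IsComponent0
          fun C : Set (Set (Hol A)) => Nat.card C = s), Nat.card_eq_fintype_card,
        Fintype.card_subtype]
    · intro C _
      have := C.2.nonempty.to_subtype
      exact Finset.mem_Icc.2 ⟨Nat.card_pos, Nat.le_of_dvd Nat.card_pos C.2.card_dvd⟩
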